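/- In any generalized grid graph with rows [0..N], if (i,d) is a reachable vertex that is not potent and i+1 ≤ N, then c(i+1,d) = c(i,d). -/

import Mathlib

namespace Stmt3

/-- Total weight of a list of vertices regarded as a walk. -/
def pathCost {V : Type*} (wt : V → V → ℕ) : List V → ℕ
  | [] => 0
  | [_] => 0
  | a :: b :: l => wt a b + pathCost wt (b :: l)

/-- `l` is a directed path (walk) from `s` to `v` in the graph with edge relation `E`. -/
def IsPath {V : Type*} (E : V → V → Prop) (s v : V) (l : List V) : Prop :=
  l.head? = some s ∧ l.getLast? = some v ∧ l.Chain' E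

/-- Shortest-path cost from `s` to `v`. -/
noncomputable def cost {V : Type*} (E : V → V → Prop) (wt : V → V → ℕ) (s v : V) : ℕ :=
  sInf { c | ∃ l : List V, IsPath E s v l ∧ pathCost wt l = c }

/-- Vertices of a generalized grid graph with rows `[0..N]` and diagonals `[-t..t]`. -/
def ggVertex (N t : ℕ) (v : ℤ × ℤ) : Prop :=
  0 ≤ v.1 ∧ v.1 ≤ (N : ℤ) ∧ -(t : ℤ) ≤ v.2 ∧ v.2 ≤ (t : ℤ)

/-- Edges of a generalized grid graph: deletion edges `(i,d) → (i+1,d-1)`,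
insertion edges `(i,d) → (i,d+1)`, vertical edges `(i,d) → (i+1,d)`;
present only when both endpoints are vertices. -/
def ggEdge (N t : ℕ) (u v : ℤ × ℤ) : Prop :=
  ggVertex N t u ∧ ggVertex N t v ∧
    (v = (u.1 + 1, u.2 - 1) ∨ v = (u.1, u.2 + 1) ∨ v = (u.1 + 1, u.2))

/-- Weights: a vertical edge `(i,d) → (i+1,d)` has weight `w (i+1) d`;
deletion and insertion edges have weight `1`. -/
def ggWt (w : ℤ → ℤ → ℕ) (u v : ℤ × ℤ) : ℕ :=
  if v = (u.1 + 1, u.2) then w v.1 v.2 else 1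

/-- A vertex `(i,d)` is reachable if `i + d ≥ 0`. -/
def Reachable (N t : ℕ) (v : ℤ × ℤ) : Prop := ggVertex N t v ∧ 0 ≤ v.1 + v.2

/-- Shortest-path cost `c(i,d)` from `(0,0)` in the generalized grid graph. -/
noncomputable def ggCost (N t : ℕ) (w : ℤ → ℤ → ℕ) (v : ℤ × ℤ) : ℕ :=
  cost (ggEdge N t) (ggWt w) (0, 0) v

/-- `(i,d)` is dominated by `(i,d-1)`. -/
def DomL (N t : ℕ) (w : ℤ → ℤ → ℕ) (v : ℤ × ℤ) : Prop :=
  Reachable N t v ∧ Reachable N t (v.1, v.2 - 1) ∧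
    ggCost N t w (v.1, v.2 - 1) + 1 = ggCost N t w v

/-- `(i,d)` is dominated by `(i-1,d+1)`. -/
def DomU (N t : ℕ) (w : ℤ → ℤ → ℕ) (v : ℤ × ℤ) : Prop :=
  Reachable N t v ∧ Reachable N t (v.1 - 1, v.2 + 1) ∧
    ggCost N t w (v.1 - 1, v.2 + 1) + 1 = ggCost N t w v

/-- Potency, defined by (well-founded, hence unambiguous) recursion in
lexicographic order: `(i,d)` is potent iff (dominated by `(i,d-1)` implies
`(i,d-1)` potent and `w (i+1) (d-1) = 1`) and (dominated by `(i-1,d+1)` implies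
`(i-1,d+1)` potent and `w i (d+1) = 1`). -/
inductive Potent (N t : ℕ) (w : ℤ → ℤ → ℕ) : ℤ × ℤ → Prop where
  | mk : ∀ v : ℤ × ℤ,
      (DomL N t w v → Potent N t w (v.1, v.2 - 1)) →
      (DomL N t w v → w (v.1 + 1) (v.2 - 1) = 1) →
      (DomU N t w v → Potent N t w (v.1 - 1, v.2 + 1)) →
      (DomU N t w v → w v.1 (v.2 + 1) = 1) →
      Potent N t w v

/-- There is a path from the origin to `v` of cost `c`. -/
def Walk (N t : ℕ) (w : ℤ → ℤ → ℕ) (v : ℤ × ℤ) (c : ℕ) : Prop :=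
  ∃ l : List (ℤ × ℤ), IsPath (ggEdge N t) (0, 0) v l ∧ pathCost (ggWt w) l = c

lemma pathCost_concat {V : Type*} (wt : V → V → ℕ) (u v : V) (l : List V) :
    pathCost wt ((l ++ [u]) ++ [v]) = pathCost wt (l ++ [u]) + wt u v := by
  induction l with
  | nil => simp [pathCost]
  | cons a l ih =>
    cases l with
    | nil => simp [pathCost]
    | cons b l =>
      simp only [List.cons_append, pathCost] at ih ⊢
      omega

lemma walk_zero (N t : ℕ) (w : ℤ → ℤ → ℕ) : Walk N t w (0, 0) 0 :=
  ⟨[(0, 0)], ⟨rfl, rfl, List.isChain_singleton _⟩, rfl⟩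

lemma walk_step {N t : ℕ} {w : ℤ → ℤ → ℕ} {u v : ℤ × ℤ} {c : ℕ} (h : Walk N t w u c)
    (e : ggEdge N t u v) : Walk N t w v (c + ggWt w u v) := by
  obtain ⟨l, ⟨h1, h2, h3⟩, h4⟩ := h
  rcases List.eq_nil_or_concat l with rfl | ⟨l', x, rfl⟩
  · simp at h1
  · simp at h2
    subst h2
    simp only [List.concat_eq_append] at h1 h3 h4
    refine ⟨(l' ++ [x]) ++ [v], ⟨?_, by simp, ?_⟩, ?_⟩
    · rw [List.head?_append, h1]; rfl
    · refine List.isChain_append.2 ⟨h3, by simp, ?_⟩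
      simpa using e
    · rw [pathCost_concat, h4]

lemma walk_inv {N t : ℕ} {w : ℤ → ℤ → ℕ} {v : ℤ × ℤ} {c : ℕ} (h : Walk N t w v c) :
    (v = (0, 0) ∧ c = 0) ∨ ∃ u c', Walk N t w u c' ∧ ggEdge N t u v ∧ c = c' + ggWt w u v := by
  obtain ⟨l, ⟨h1, h2, h3⟩, h4⟩ := h
  rcases List.eq_nil_or_concat l with rfl | ⟨l', x, rfl⟩
  · simp at h1
  · simp at h2
    subst h2
    simp only [List.concat_eq_append] at *
    rcases List.eq_nil_or_concat l' with rfl | ⟨l'', u, rfl⟩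
    · left
      simp at h1
      exact ⟨h1, by simpa [pathCost] using h4.symm⟩
    · right
      simp only [List.concat_eq_append] at *
      obtain ⟨h5, -, h6⟩ := List.isChain_append.1 h3
      refine ⟨u, _, ⟨l'' ++ [u], ⟨?_, by simp, h5⟩, rfl⟩, ?_, ?_⟩
      · cases l'' <;> simpa using h1
      · simpa using h6
      · rw [← h4, pathCost_concat]

lemma cost_le {N t : ℕ} {w : ℤ → ℤ → ℕ} {v : ℤ × ℤ} {c : ℕ} (h : Walk N t w v c) :
    ggCost N t w v ≤ c := Nat.sInf_le h

lemma cost_walk {N t : ℕ} {w : ℤ → ℤ → ℕ} {v : ℤ × ℤ} {c : ℕ} (h : Walk N t w v c) :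
    Walk N t w v (ggCost N t w v) :=
  Nat.sInf_mem (s := {c | Walk N t w v c}) ⟨c, h⟩

lemma wt_del (w : ℤ → ℤ → ℕ) (i d i' d' : ℤ) (h : d ≠ d') :
    ggWt w (i, d) (i', d') = 1 := by
  have : d' ≠ d := fun e => h e.symm
  simp [ggWt, this]

lemma wt_vert (w : ℤ → ℤ → ℕ) (i d : ℤ) : ggWt w (i, d) (i + 1, d) = w (i + 1) d := by
  simp [ggWt]

lemma reach_walk (N t : ℕ) (w : ℤ → ℤ → ℕ) (n : ℕ) : ∀ i d : ℤ, 2 * i + d ≤ n →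
    Reachable N t (i, d) → ∃ c, Walk N t w (i, d) c := by
  induction n with
  | zero =>
    intro i d h hr
    simp only [Reachable, ggVertex] at hr
    obtain rfl : i = 0 := by omega
    obtain rfl : d = 0 := by omega
    exact ⟨0, walk_zero N t w⟩
  | succ n ih =>
    intro i d h hr
    have hr' := hr
    simp only [Reachable, ggVertex] at hr'
    have key : ∀ i' d' : ℤ, 2 * i' + d' ≤ n → Reachable N t (i', d') →
        ((i, d) = (i' + 1, d' - 1) ∨ (i, d) = (i', d' + 1) ∨ (i, d) = (i' + 1, d')) →
        ∃ c, Walk N t w (i, d) c := by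
      intro i' d' h1 h2 h3
      obtain ⟨c, hc⟩ := ih i' d' h1 h2
      exact ⟨_, walk_step hc ⟨h2.1, hr.1, h3⟩⟩
    push_cast at h
    by_cases hi : i = 0
    · by_cases hd : d = 0
      · subst hi hd
        exact ⟨0, walk_zero N t w⟩
      · refine key i (d - 1) (by omega) ?_ (by simp)
        simp only [Reachable, ggVertex]; omega
    · by_cases hd : i + d = 0
      · refine key (i - 1) (d + 1) (by omega) ?_ (by simp)
        simp only [Reachable, ggVertex]; omega
      · refine key (i - 1) d (by omega) ?_ (by simp)
        simp only [Reachable, ggVertex]; omega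

lemma reach_cost {N t : ℕ} (w : ℤ → ℤ → ℕ) {i d : ℤ} (h : Reachable N t (i, d)) :
    Walk N t w (i, d) (ggCost N t w (i, d)) := by
  obtain ⟨c, hc⟩ := reach_walk N t w (2 * i + d).toNat i d (by omega) h
  exact cost_walk hc

lemma walk_bound {N t : ℕ} {w : ℤ → ℤ → ℕ} (l : List (ℤ × ℤ)) : ∀ v : ℤ × ℤ,
    IsPath (ggEdge N t) (0, 0) v l →
    0 ≤ v.1 + v.2 ∧ -v.2 ≤ pathCost (ggWt w) l ∧ v.2 ≤ pathCost (ggWt w) l := by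
  induction l using List.reverseRecOn with
  | nil => rintro v ⟨h1, -⟩; simp at h1
  | append_singleton l x ih =>
    rintro v ⟨h1, h2, h3⟩
    simp at h2
    subst h2
    rcases List.eq_nil_or_concat l with rfl | ⟨l'', u, rfl⟩
    · simp at h1
      simp [h1]
    · simp only [List.concat_eq_append] at *
      obtain ⟨h5, -, h6⟩ := List.isChain_append.1 h3
      have := ih u ⟨by cases l'' <;> simpa using h1, by simp, h5⟩
      rw [pathCost_concat]
      have e : ggEdge N t u x := by simpa using h6
      obtain ⟨i, d⟩ := u
      obtain ⟨-, -, rfl | rfl | rfl⟩ := e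
      · rw [wt_del _ _ _ _ _ (by simp only; omega)]
        push_cast
        simp only at *
        omega
      · rw [wt_del _ _ _ _ _ (by simp only; omega)]
        push_cast
        simp only at *
        omega
      · push_cast
        simp only at *
        omega

lemma walk_reach {N t : ℕ} {w : ℤ → ℤ → ℕ} {i d : ℤ} {c : ℕ} (h : Walk N t w (i, d) c) :
    0 ≤ i + d ∧ -d ≤ c ∧ d ≤ c := by
  obtain ⟨l, h1, rfl⟩ := h
  exact walk_bound l _ h1

lemma cost_ins {N t : ℕ} (w : ℤ → ℤ → ℕ) {i d : ℤ} (h : Reachable N t (i, d - 1))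
    (h' : Reachable N t (i, d)) : ggCost N t w (i, d) ≤ ggCost N t w (i, d - 1) + 1 := by
  have := walk_step (v := (i, d)) (reach_cost w h) ⟨h.1, h'.1, by simp⟩
  rw [wt_del _ _ _ _ _ (by omega)] at this
  exact cost_le this

lemma cost_del {N t : ℕ} (w : ℤ → ℤ → ℕ) {i d : ℤ} (h : Reachable N t (i - 1, d + 1))
    (h' : Reachable N t (i, d)) : ggCost N t w (i, d) ≤ ggCost N t w (i - 1, d + 1) + 1 := by
  have := walk_step (v := (i, d)) (reach_cost w h) ⟨h.1, h'.1, by simp⟩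
  rw [wt_del _ _ _ _ _ (by omega)] at this
  exact cost_le this

lemma cost_vert {N t : ℕ} (w : ℤ → ℤ → ℕ) {i d : ℤ} (h : Reachable N t (i, d))
    (h' : Reachable N t (i + 1, d)) :
    ggCost N t w (i + 1, d) ≤ ggCost N t w (i, d) + w (i + 1) d := by
  have := walk_step (v := (i + 1, d)) (reach_cost w h) ⟨h.1, h'.1, by simp⟩
  rw [wt_vert] at this
  exact cost_le this

lemma cost_row_zero {N t : ℕ} (w : ℤ → ℤ → ℕ) (n : ℕ) (h : Reachable N t (0, (n : ℤ))) :
    ggCost N t w (0, (n : ℤ)) ≤ n := by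
  induction n with
  | zero => exact cost_le (walk_zero N t w)
  | succ n ih =>
    have h0 : Reachable N t (0, (n : ℤ)) := by
      simp only [Reachable, ggVertex] at h ⊢; push_cast at h; omega
    have e : ((n + 1 : ℕ) : ℤ) - 1 = n := by push_cast; ring
    have := cost_ins w (by rwa [e]) h
    rw [e] at this
    have := ih h0
    omega

lemma cost_col_zero {N t : ℕ} (w : ℤ → ℤ → ℕ) (n : ℕ) (h : Reachable N t ((n : ℤ), -(n : ℤ))) :
    ggCost N t w ((n : ℤ), -(n : ℤ)) ≤ n := by
  induction n with
  | zero => exact cost_le (walk_zero N t w)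
  | succ n ih =>
    have h0 : Reachable N t ((n : ℤ), -(n : ℤ)) := by
      simp only [Reachable, ggVertex] at h ⊢; push_cast at h; omega
    have e : ((n + 1 : ℕ) : ℤ) - 1 = n := by push_cast; ring
    have e' : -((n + 1 : ℕ) : ℤ) + 1 = -n := by push_cast; ring
    have := cost_del w (by rwa [e, e']) h
    rw [e, e'] at this
    have := ih h0
    omega

lemma cost_mono {N t : ℕ} (w : ℤ → ℤ → ℕ) (n : ℕ) : ∀ i d : ℤ, 2 * i + d < n →
    Reachable N t (i, d) → Reachable N t (i + 1, d) →
    ggCost N t w (i, d) ≤ ggCost N t w (i + 1, d) := by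
  induction n with
  | zero =>
    intro i d h hr
    simp only [Reachable, ggVertex] at hr
    omega
  | succ n ih =>
    intro i d h hr hr1
    have hr' := hr
    have hr1' := hr1
    simp only [Reachable, ggVertex] at hr' hr1'
    push_cast at h
    rcases walk_inv (reach_cost w hr1) with ⟨h1, -⟩ | ⟨⟨i', d'⟩, c', h1, h2, h3⟩
    · simp at h1
      omega
    have hb := walk_reach h1
    have hle := cost_le h1
    obtain ⟨h4, -, h5 | h5 | h5⟩ := h2
    · simp only [Prod.mk.injEq] at h5
      obtain rfl : i' = i := by omega
      obtain rfl : d' = d + 1 := by omega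
      rw [wt_del _ _ _ _ _ (by omega)] at h3
      by_cases hi : i' = 0
      · subst hi
        lift d to ℕ using by omega
        have := cost_row_zero w d hr
        omega
      · have r1 : Reachable N t (i' - 1, d + 1) := by
          simp only [Reachable, ggVertex] at *; omega
        have r2 : Reachable N t (i' - 1 + 1, d + 1) := by
          simp only [Reachable, ggVertex] at *; omega
        have a := ih (i' - 1) (d + 1) (by omega) r1 r2
        have b := cost_del w r1 hr
        rw [sub_add_cancel] at a
        omega
    · simp only [Prod.mk.injEq] at h5
      obtain rfl : i' = i + 1 := by omega
      obtain rfl : d' = d - 1 := by omega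
      rw [wt_del _ _ _ _ _ (by omega)] at h3
      by_cases hi : i + d = 0
      · obtain rfl : d = -i := by omega
        lift i to ℕ using by omega
        have := cost_col_zero w i hr
        omega
      · have r1 : Reachable N t (i, d - 1) := by
          simp only [Reachable, ggVertex] at *; omega
        have r2 : Reachable N t (i + 1, d - 1) := by
          simp only [Reachable, ggVertex] at *; omega
        have a := ih i (d - 1) (by omega) r1 r2
        have b := cost_ins w r1 hr
        omega
    · simp only [Prod.mk.injEq] at h5
      obtain rfl : i' = i := by omega
      obtain rfl : d' = d := by omega
      omega

lemma cost_nonpotent {N t : ℕ} (w : ℤ → ℤ → ℕ) (hw1 : ∀ i d, w i d ≤ 1) (n : ℕ) :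
    ∀ i d : ℤ, 2 * i + d < n →
    Reachable N t (i, d) → ¬ Potent N t w (i, d) → i + 1 ≤ (N : ℤ) →
    ggCost N t w (i + 1, d) ≤ ggCost N t w (i, d) := by
  induction n with
  | zero =>
    intro i d h hr
    simp only [Reachable, ggVertex] at hr
    omega
  | succ n ih =>
    intro i d h hr hnp hN
    push_cast at h
    have hr1 : Reachable N t (i + 1, d) := by
      simp only [Reachable, ggVertex] at *; omega
    have hL : DomL N t w (i, d) →
        (¬ Potent N t w (i, d - 1) ∨ w (i + 1) (d - 1) ≠ 1) →
        ggCost N t w (i + 1, d) ≤ ggCost N t w (i, d) := by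
      rintro ⟨-, r1, e⟩ hc
      simp only at r1 e
      have r2 : Reachable N t (i + 1, d - 1) := by
        simp only [Reachable, ggVertex] at *; omega
      have a := cost_ins w r2 hr1
      have b : ggCost N t w (i + 1, d - 1) ≤ ggCost N t w (i, d - 1) := by
        rcases hc with hc | hc
        · exact ih i (d - 1) (by omega) r1 hc hN
        · have := cost_vert w r1 r2
          have := hw1 (i + 1) (d - 1)
          omega
      omega
    have hU : DomU N t w (i, d) →
        (¬ Potent N t w (i - 1, d + 1) ∨ w i (d + 1) ≠ 1) →
        ggCost N t w (i + 1, d) ≤ ggCost N t w (i, d) := by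
      rintro ⟨-, r1, e⟩ hc
      simp only at r1 e
      have r2 : Reachable N t (i, d + 1) := by
        simp only [Reachable, ggVertex] at *; omega
      have a := cost_del w (by rwa [add_sub_cancel_right]) hr1
      rw [add_sub_cancel_right] at a
      have b : ggCost N t w (i, d + 1) ≤ ggCost N t w (i - 1, d + 1) := by
        rcases hc with hc | hc
        · have := ih (i - 1) (d + 1) (by omega) r1 hc (by omega)
          rwa [sub_add_cancel] at this
        · have := cost_vert w r1 (by rwa [sub_add_cancel])
          rw [sub_add_cancel] at this
          have := hw1 i (d + 1)
          omega
      omega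
    by_contra hcon
    refine hnp (Potent.mk _ ?_ ?_ ?_ ?_)
    · intro hd; by_contra hc; exact hcon (hL hd (Or.inl hc))
    · intro hd; by_contra hc; exact hcon (hL hd (Or.inr hc))
    · intro hd; by_contra hc; exact hcon (hU hd (Or.inl hc))
    · intro hd; by_contra hc; exact hcon (hU hd (Or.inr hc))

theorem stmt3 (N t : ℕ) (w : ℤ → ℤ → ℕ)
    (hw1 : ∀ i d, w i d ≤ 1)
    (hw0 : ∀ i d : ℤ, ¬(1 ≤ i ∧ i ≤ (N : ℤ) ∧ -(t : ℤ) ≤ d ∧ d ≤ (t : ℤ)) → w i d = 0)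
    (i d : ℤ) (hr : Reachable N t (i, d)) (hnp : ¬ Potent N t w (i, d))
    (hiN : i + 1 ≤ (N : ℤ)) :
    ggCost N t w (i + 1, d) = ggCost N t w (i, d) := by
  have hr1 : Reachable N t (i + 1, d) := by
    simp only [Reachable, ggVertex] at *; omega
  apply le_antisymm
  · exact cost_nonpotent w hw1 ((2 * i + d).toNat + 1) i d (by omega) hr hnp hiN
  · exact cost_mono w ((2 * i + d).toNat + 1) i d (by omega) hr hr1

end Stmt3
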